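/- Let z be a real number with z ≠ 0. Let p, q : ℕ → ℝ both satisfy the recurrence u(n) = (11n² - 11n + 3 + 9z²)·u(n-1) + ((n-1)² + 4z²)((n-1)² + 9z²)·u(n-2) for all n ≥ 2, with initial values p(0) = 0, p(1) = 5, q(0) = 1, q(1) = 3(1 - z²). Then for all sufficiently large n, q(n) ≠ 0, and the sequence p(n)/q(n) converges to (cosh(πz) - 1)/(3z²); moreover (cosh(πz) - 1)/(3z²) - p(n)/q(n) is asymptotically equivalent (as n → ∞) to (-1)ⁿ·(2/(3z²))·sinh(2πz)·sinh(3πz)/((1+√5)/2)^{10n+5}. -/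

import Mathlib

open Filter Real Asymptotics

/-- The product `∏_{j=1}^m (j² + x)`. -/
noncomputable def sqAddProd (x : ℝ) (m : ℕ) : ℝ := ∏ j ∈ Finset.range m, (((j : ℝ) + 1) ^ 2 + x)

/-- The general term of the well-poised series whose sum is the minimal solution, up to an
explicit factor. -/
noncomputable def wpTerm (x y : ℝ) (n m : ℕ) : ℝ :=
  (m.descFactorial n : ℝ) * sqAddProd x m / sqAddProd y (m + n + 1)

/-- The certificate for creative telescoping of `wpTerm x (4 * x) (n + 1)`. -/
noncomputable def wpCert (x : ℝ) (n m : ℕ) : ℝ :=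
  (m.descFactorial n : ℝ) * sqAddProd x m / sqAddProd (4 * x) (m + n + 1) *
    (((n : ℝ) + 1) * ((m : ℝ) + 1) ^ 2
      - (3 * ((n : ℝ) + 1) * (2 * (n : ℝ) + 1) + 12 * x) * ((m : ℝ) + 1)
      - ((n : ℝ) + 1) * (11 * ((n : ℝ) + 1) ^ 2 - 13 * ((n : ℝ) + 1) + 4) - 4 * ((n : ℝ) + 1) * x)

theorem sqAddProd_zero_right (x : ℝ) : sqAddProd x 0 = 1 := by simp [sqAddProd]

theorem sqAddProd_succ (x : ℝ) (m : ℕ) :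
    sqAddProd x (m + 1) = sqAddProd x m * (((m : ℝ) + 1) ^ 2 + x) := by
  simp [sqAddProd, Finset.prod_range_succ]

theorem sqAddProd_pos {x : ℝ} (hx : 0 ≤ x) (m : ℕ) : 0 < sqAddProd x m :=
  Finset.prod_pos fun _ _ => by positivity

theorem sqAddProd_zero_left (m : ℕ) : sqAddProd 0 m = (m.factorial : ℝ) ^ 2 := by
  induction m with
  | zero => simp [sqAddProd]
  | succ m ih => rw [sqAddProd_succ, ih, Nat.factorial_succ]; push_cast; ring

theorem cast_descFactorial_succ (m n : ℕ) :
    (m.descFactorial (n + 1) : ℝ) = ((m : ℝ) - n) * m.descFactorial n := by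
  rw [Nat.descFactorial_succ, Nat.cast_mul]
  rcases le_or_gt n m with h | h
  · rw [Nat.cast_sub h]
  · simp [Nat.descFactorial_of_lt h]

theorem wpTerm_telescope {x : ℝ} (hx : 0 ≤ x) (n m : ℕ) :
    (((n : ℝ) + 2) ^ 2 + 4 * x) * (((n : ℝ) + 2) ^ 2 + 9 * x) * wpTerm x (4 * x) (n + 2) m
      + ((n : ℝ) + 2) * (11 * ((n : ℝ) + 2) ^ 2 - 11 * ((n : ℝ) + 2) + 3 + 9 * x)
        * wpTerm x (4 * x) (n + 1) m
      - ((n : ℝ) + 2) * ((n : ℝ) + 1) * wpTerm x (4 * x) n m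
      = wpCert x (n + 1) (m + 1) - wpCert x (n + 1) m := by
  have h4 : (0 : ℝ) ≤ 4 * x := by positivity
  have hV := (sqAddProd_pos h4 (m + n)).ne'
  obtain ⟨M, hM⟩ : ∃ M, M = m + n := ⟨_, rfl⟩
  have e0 : m + n + 1 = M + 1 := by omega
  have e1 : m + (n + 2) + 1 = M + 1 + 1 + 1 := by omega
  have e2 : m + (n + 1) + 1 = M + 1 + 1 := by omega
  have e3 : m + 1 + (n + 1) + 1 = M + 1 + 1 + 1 := by omega
  simp only [wpTerm, wpCert, e0, e1, e2, e3, sqAddProd_succ, Nat.succ_descFactorial_succ,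
    cast_descFactorial_succ]
  rw [← hM] at hV
  have p0 : ((M : ℝ) + 1) ^ 2 + 4 * x ≠ 0 := by positivity
  have p1 : ((M : ℝ) + 1 + 1) ^ 2 + 4 * x ≠ 0 := by positivity
  have p2 : ((M : ℝ) + 1 + 1 + 1) ^ 2 + 4 * x ≠ 0 := by positivity
  push_cast
  field_simp
  rw [hM]
  push_cast
  ring

theorem wpTerm_telescope_zero {x : ℝ} (hx : 0 ≤ x) (m : ℕ) :
    (1 + 4 * x) * (1 + 9 * x) * wpTerm x (4 * x) 1 m + (3 + 9 * x) * wpTerm x (4 * x) 0 m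
      = wpCert x 0 (m + 1) - wpCert x 0 m := by
  have h4 : (0 : ℝ) ≤ 4 * x := by positivity
  have hV := (sqAddProd_pos h4 m).ne'
  simp only [wpTerm, wpCert, add_zero, sqAddProd_succ, Nat.descFactorial_zero,
    Nat.descFactorial_one]
  have p1 : ((m : ℝ) + 1) ^ 2 + 4 * x ≠ 0 := by positivity
  have p2 : (((m + 1 : ℕ) : ℝ) + 1) ^ 2 + 4 * x ≠ 0 := by positivity
  push_cast at p1 p2 ⊢
  field_simp
  ring

theorem wpTerm_zero_telescope {x : ℝ} (hx : 0 ≤ x) (m : ℕ) :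
    3 * x * wpTerm x (4 * x) 0 m
      = sqAddProd x m / sqAddProd (4 * x) m - sqAddProd x (m + 1) / sqAddProd (4 * x) (m + 1) := by
  have h4 : (0 : ℝ) ≤ 4 * x := by positivity
  have hV := (sqAddProd_pos h4 m).ne'
  simp only [wpTerm, add_zero, sqAddProd_succ, Nat.descFactorial_zero]
  have p1 : ((m : ℝ) + 1) ^ 2 + 4 * x ≠ 0 := by positivity
  field_simp
  ring

theorem sqAddProd_mul_factorial_le {x y : ℝ} (hx : 0 ≤ x) (hxy : x ≤ y) {m k : ℕ} (hmk : m ≤ k) :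
    sqAddProd x m * (k.factorial : ℝ) ^ 2 ≤ sqAddProd y k * (m.factorial : ℝ) ^ 2 := by
  induction k, hmk using Nat.le_induction with
  | base =>
    gcongr
    unfold sqAddProd
    gcongr
  | succ k _ ih =>
    rw [sqAddProd_succ, Nat.factorial_succ]
    push_cast
    have h1 : ((k : ℝ) + 1) ^ 2 ≤ ((k : ℝ) + 1) ^ 2 + y := by linarith
    have h2 : (0 : ℝ) ≤ sqAddProd y k := (sqAddProd_pos (hx.trans hxy) k).le
    calc sqAddProd x m * (((k : ℝ) + 1) * k.factorial) ^ 2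
        = (sqAddProd x m * (k.factorial : ℝ) ^ 2) * ((k : ℝ) + 1) ^ 2 := by ring
      _ ≤ (sqAddProd y k * (m.factorial : ℝ) ^ 2) * (((k : ℝ) + 1) ^ 2 + y) := by gcongr
      _ = _ := by ring

theorem wpTerm_nonneg {x y : ℝ} (hx : 0 ≤ x) (hy : 0 ≤ y) (n m : ℕ) : 0 ≤ wpTerm x y n m := by
  have h1 := (sqAddProd_pos hx m).le
  have h2 := (sqAddProd_pos hy (m + n + 1)).le
  unfold wpTerm
  positivity

theorem wpTerm_le_wpTerm_zero {x y : ℝ} (hx : 0 ≤ x) (hxy : x ≤ y) (n m : ℕ) :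
    wpTerm x y n m ≤ wpTerm 0 0 n m := by
  have h := sqAddProd_mul_factorial_le hx hxy (show m ≤ m + n + 1 by omega)
  have h2 := sqAddProd_pos (hx.trans hxy) (m + n + 1)
  unfold wpTerm
  rw [sqAddProd_zero_left, sqAddProd_zero_left, mul_div_assoc, mul_div_assoc]
  refine mul_le_mul_of_nonneg_left ?_ (by positivity)
  rw [div_le_div_iff₀ h2 (by positivity)]
  linarith

theorem wpTerm_zero_le (n m : ℕ) : wpTerm 0 0 n m ≤ 1 / ((m : ℝ) + 1) ^ (n + 2) := by
  unfold wpTerm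
  rw [sqAddProd_zero_left, sqAddProd_zero_left]
  have h1 : (m.descFactorial n : ℝ) ≤ ((m : ℝ) + 1) ^ n := by
    have : m.descFactorial n ≤ m ^ n := Nat.descFactorial_le_pow m n
    calc (m.descFactorial n : ℝ) ≤ (m : ℝ) ^ n := by exact_mod_cast this
      _ ≤ _ := by gcongr; linarith
  have h2 : (m.factorial : ℝ) * ((m : ℝ) + 1) ^ (n + 1) ≤ ((m + n + 1).factorial : ℝ) := by
    exact_mod_cast Nat.factorial_mul_pow_le_factorial (m := m) (n := n + 1)
  rw [div_le_div_iff₀ (by positivity) (by positivity)]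
  calc (m.descFactorial n : ℝ) * (m.factorial : ℝ) ^ 2 * ((m : ℝ) + 1) ^ (n + 2)
      ≤ ((m : ℝ) + 1) ^ n * (m.factorial : ℝ) ^ 2 * ((m : ℝ) + 1) ^ (n + 2) := by gcongr
    _ = ((m.factorial : ℝ) * ((m : ℝ) + 1) ^ (n + 1)) ^ 2 := by ring
    _ ≤ ((m + n + 1).factorial : ℝ) ^ 2 := by gcongr
    _ = _ := by ring

theorem wpTerm_le {x y : ℝ} (hx : 0 ≤ x) (hxy : x ≤ y) (n m : ℕ) :
    wpTerm x y n m ≤ 1 / ((m : ℝ) + 1) ^ (n + 2) :=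
  (wpTerm_le_wpTerm_zero hx hxy n m).trans (wpTerm_zero_le n m)

theorem summable_wpTerm {x y : ℝ} (hx : 0 ≤ x) (hxy : x ≤ y) (n : ℕ) :
    Summable (wpTerm x y n) := by
  have h : Summable fun m : ℕ => 1 / ((m : ℝ) + 1) ^ (n + 2) := by
    have := (summable_nat_add_iff 1).2 (Real.summable_one_div_nat_pow.2 (show 1 < n + 2 by omega))
    simpa using this
  exact Summable.of_nonneg_of_le (wpTerm_nonneg hx (hx.trans hxy) n) (wpTerm_le hx hxy n) h

theorem wpCert_eq (x : ℝ) (n m : ℕ) : wpCert x n m = wpTerm x (4 * x) n m *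
    (((n : ℝ) + 1) * ((m : ℝ) + 1) ^ 2
      - (3 * ((n : ℝ) + 1) * (2 * (n : ℝ) + 1) + 12 * x) * ((m : ℝ) + 1)
      - ((n : ℝ) + 1) * (11 * ((n : ℝ) + 1) ^ 2 - 13 * ((n : ℝ) + 1) + 4)
      - 4 * ((n : ℝ) + 1) * x) := rfl

theorem abs_quadratic_le (a b c d t : ℝ) (ht : 1 ≤ t) :
    |a * t ^ 2 - b * t - c - d| ≤ (|a| + |b| + |c| + |d|) * t ^ 2 := by
  have h1 : t ≤ t ^ 2 := by nlinarith
  have h2 : 1 ≤ t ^ 2 := by nlinarith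
  calc |a * t ^ 2 - b * t - c - d| ≤ |a * t ^ 2| + |b * t| + |c| + |d| := by
        refine (abs_sub _ _).trans ?_
        gcongr
        refine (abs_sub _ _).trans ?_
        gcongr
        exact abs_sub _ _
    _ = |a| * t ^ 2 + |b| * t + |c| * 1 + |d| * 1 := by
        rw [abs_mul, abs_mul, abs_of_nonneg (by positivity : 0 ≤ t ^ 2),
          abs_of_nonneg (by positivity : 0 ≤ t)]
        ring
    _ ≤ |a| * t ^ 2 + |b| * t ^ 2 + |c| * t ^ 2 + |d| * t ^ 2 := by gcongr
    _ = _ := by ring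

theorem tendsto_wpCert_succ {x : ℝ} (hx : 0 ≤ x) (n : ℕ) :
    Tendsto (wpCert x (n + 1)) atTop (nhds 0) := by
  have h4 : x ≤ 4 * x := by linarith
  set C : ℝ := |((n + 1 : ℕ) : ℝ) + 1|
    + |3 * (((n + 1 : ℕ) : ℝ) + 1) * (2 * ((n + 1 : ℕ) : ℝ) + 1) + 12 * x|
    + |(((n + 1 : ℕ) : ℝ) + 1) * (11 * (((n + 1 : ℕ) : ℝ) + 1) ^ 2
        - 13 * (((n + 1 : ℕ) : ℝ) + 1) + 4)| + |4 * (((n + 1 : ℕ) : ℝ) + 1) * x| with hC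
  have hC0 : 0 ≤ C := by positivity
  have hlim : Tendsto (fun m : ℕ => C * (1 / ((m : ℝ) + 1))) atTop (nhds 0) := by
    simpa using tendsto_one_div_add_atTop_nhds_zero_nat.const_mul C
  refine squeeze_zero_norm (fun m => ?_) hlim
  have ht : (1 : ℝ) ≤ (m : ℝ) + 1 := by linarith [Nat.cast_nonneg (α := ℝ) m]
  rw [wpCert_eq, norm_mul, Real.norm_of_nonneg (wpTerm_nonneg hx (hx.trans h4) _ _)]
  calc _ ≤ 1 / ((m : ℝ) + 1) ^ (n + 1 + 2) * (C * ((m : ℝ) + 1) ^ 2) := by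
        refine mul_le_mul (wpTerm_le hx h4 _ _) (abs_quadratic_le _ _ _ _ _ ht) (norm_nonneg _)
          (by positivity)
    _ = C * (1 / ((m : ℝ) + 1) ^ (n + 1)) := by
        field_simp
        ring
    _ ≤ C * (1 / ((m : ℝ) + 1)) := by
        gcongr
        exact le_self_pow₀ ht (by omega)

theorem tsum_eq_of_telescope {f g : ℕ → ℝ} {l : ℝ} (hf : Summable f)
    (h : ∀ m, f m = g (m + 1) - g m) (hg : Tendsto g atTop (nhds l)) :
    ∑' m, f m = l - g 0 := by
  refine tendsto_nhds_unique hf.hasSum.tendsto_sum_nat ?_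
  simp only [h, Finset.sum_range_sub]
  exact hg.sub_const _

/-- The sum of the well-poised series. -/
noncomputable def wpSum (x y : ℝ) (n : ℕ) : ℝ := ∑' m, wpTerm x y n m

theorem wpSum_recurrence {x : ℝ} (hx : 0 ≤ x) (n : ℕ) :
    (((n : ℝ) + 2) ^ 2 + 4 * x) * (((n : ℝ) + 2) ^ 2 + 9 * x) * wpSum x (4 * x) (n + 2)
      + ((n : ℝ) + 2) * (11 * ((n : ℝ) + 2) ^ 2 - 11 * ((n : ℝ) + 2) + 3 + 9 * x)
        * wpSum x (4 * x) (n + 1)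
      - ((n : ℝ) + 2) * ((n : ℝ) + 1) * wpSum x (4 * x) n = 0 := by
  have h4 : x ≤ 4 * x := by linarith
  have s0 := (summable_wpTerm hx h4 n).mul_left (((n : ℝ) + 2) * ((n : ℝ) + 1))
  have s1 := (summable_wpTerm hx h4 (n + 1)).mul_left
    (((n : ℝ) + 2) * (11 * ((n : ℝ) + 2) ^ 2 - 11 * ((n : ℝ) + 2) + 3 + 9 * x))
  have s2 := (summable_wpTerm hx h4 (n + 2)).mul_left
    ((((n : ℝ) + 2) ^ 2 + 4 * x) * (((n : ℝ) + 2) ^ 2 + 9 * x))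
  have h := tsum_eq_of_telescope ((s2.add s1).sub s0) (wpTerm_telescope hx n)
    (tendsto_wpCert_succ hx n)
  rw [(s2.add s1).tsum_sub s0, s2.tsum_add s1, tsum_mul_left, tsum_mul_left, tsum_mul_left] at h
  rw [wpSum, wpSum, wpSum, h]
  simp [wpCert]

theorem tendsto_sqAddProd_div_factorial {z : ℝ} (hz : z ≠ 0) :
    Tendsto (fun m : ℕ => sqAddProd (z ^ 2) m / (m.factorial : ℝ) ^ 2) atTop
      (nhds (Real.sinh (π * z) / (π * z))) := by
  have h := Complex.tendsto_euler_sin_prod (z * Complex.I)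
  have e : ∀ m : ℕ, (π : ℂ) * (z * Complex.I) *
      ∏ j ∈ Finset.range m, (1 - ((z : ℂ) * Complex.I) ^ 2 / ((j : ℂ) + 1) ^ 2)
      = ((π * z * (sqAddProd (z ^ 2) m / (m.factorial : ℝ) ^ 2) : ℝ) : ℂ) * Complex.I := by
    intro m
    have : sqAddProd (z ^ 2) m / (m.factorial : ℝ) ^ 2
        = ∏ j ∈ Finset.range m, (1 + z ^ 2 / ((j : ℝ) + 1) ^ 2) := by
      rw [← sqAddProd_zero_left, sqAddProd, sqAddProd, ← Finset.prod_div_distrib]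
      refine Finset.prod_congr rfl fun j _ => ?_
      have : (j : ℝ) + 1 ≠ 0 := by positivity
      field_simp
      ring
    rw [this]
    push_cast
    simp only [mul_pow, Complex.I_sq]
    ring_nf
  simp only [e] at h
  rw [← mul_assoc, Complex.sin_mul_I] at h
  have h2 := ((Complex.continuous_im.tendsto _).comp h).div_const (π * z)
  have e2 : (Complex.sinh ((π : ℂ) * z) * Complex.I).im = Real.sinh (π * z) := by
    rw [← Complex.ofReal_mul, ← Complex.ofReal_sinh, Complex.im_ofReal_mul, Complex.I_im, mul_one]
  rw [e2] at h2
  refine h2.congr fun m => ?_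
  have : π * z ≠ 0 := mul_ne_zero Real.pi_ne_zero hz
  simp only [Function.comp, Complex.im_ofReal_mul, Complex.I_im]
  field_simp

theorem tendsto_sqAddProd_ratio {z : ℝ} (hz : z ≠ 0) :
    Tendsto (fun m : ℕ => sqAddProd (z ^ 2) m / sqAddProd (4 * z ^ 2) m) atTop
      (nhds (1 / Real.cosh (π * z))) := by
  have h1 := tendsto_sqAddProd_div_factorial hz
  have h2 := tendsto_sqAddProd_div_factorial (mul_ne_zero two_ne_zero hz)
  have hs : Real.sinh (π * z) ≠ 0 := by
    rw [Ne, Real.sinh_eq_zero]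
    exact mul_ne_zero Real.pi_ne_zero hz
  have hpz : π * z ≠ 0 := mul_ne_zero Real.pi_ne_zero hz
  have hc := (Real.cosh_pos (π * z)).ne'
  have e : π * (2 * z) = 2 * (π * z) := by ring
  rw [e, Real.sinh_two_mul, show (2 * z) ^ 2 = 4 * z ^ 2 by ring] at h2
  have h3 := h1.div h2 (by positivity)
  have e3 : Real.sinh (π * z) / (π * z)
      / (2 * Real.sinh (π * z) * Real.cosh (π * z) / (2 * (π * z))) = 1 / Real.cosh (π * z) := by
    field_simp
  rw [e3] at h3
  refine h3.congr fun m => ?_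
  have := (sqAddProd_pos (by positivity : 0 ≤ 4 * z ^ 2) m).ne'
  simp only [Pi.div_apply]
  field_simp

theorem wpSum_zero {z : ℝ} (hz : z ≠ 0) :
    wpSum (z ^ 2) (4 * z ^ 2) 0 = (1 - 1 / Real.cosh (π * z)) / (3 * z ^ 2) := by
  have hx : 0 ≤ z ^ 2 := by positivity
  have s := (summable_wpTerm hx (by linarith : z ^ 2 ≤ 4 * z ^ 2) 0).mul_left (3 * z ^ 2)
  have h := tsum_eq_of_telescope s
    (g := fun m => - (sqAddProd (z ^ 2) m / sqAddProd (4 * z ^ 2) m))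
    (fun m => by rw [wpTerm_zero_telescope hx]; ring) (tendsto_sqAddProd_ratio hz).neg
  rw [tsum_mul_left] at h
  simp only [sqAddProd_zero_right] at h
  rw [wpSum, eq_div_iff (by positivity), mul_comm, h]
  ring

theorem wpSum_one {z : ℝ} (hz : z ≠ 0) :
    (1 + 4 * z ^ 2) * (1 + 9 * z ^ 2) * wpSum (z ^ 2) (4 * z ^ 2) 1
      + (3 + 9 * z ^ 2) * wpSum (z ^ 2) (4 * z ^ 2) 0 = 1 / Real.cosh (π * z) + 4 := by
  have hx : 0 ≤ z ^ 2 := by positivity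
  have h4 : z ^ 2 ≤ 4 * z ^ 2 := by linarith
  have s0 := (summable_wpTerm hx h4 0).mul_left (3 + 9 * z ^ 2)
  have s1 := (summable_wpTerm hx h4 1).mul_left ((1 + 4 * z ^ 2) * (1 + 9 * z ^ 2))
  have hi : Tendsto (fun m : ℕ => 1 / ((m : ℝ) + 1)) atTop (nhds 0) :=
    tendsto_one_div_add_atTop_nhds_zero_nat
  have hq : Tendsto (fun m : ℕ => (1 - (3 + 12 * z ^ 2) * (1 / ((m : ℝ) + 1))
      - (2 + 4 * z ^ 2) * (1 / ((m : ℝ) + 1)) ^ 2) / (1 + 4 * z ^ 2 * (1 / ((m : ℝ) + 1)) ^ 2))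
      atTop (nhds 1) := by
    have h1 := ((hi.const_mul (3 + 12 * z ^ 2)).const_sub 1).sub
      ((hi.pow 2).const_mul (2 + 4 * z ^ 2))
    have h2 := ((hi.pow 2).const_mul (4 * z ^ 2)).const_add 1
    have := h1.div h2 (by norm_num)
    simpa [Pi.div_def] using this
  have hl := (tendsto_sqAddProd_ratio hz).mul hq
  rw [mul_one] at hl
  have h := tsum_eq_of_telescope (s1.add s0) (wpTerm_telescope_zero hx)
      (l := 1 / Real.cosh (π * z)) <| by
    refine hl.congr fun m => ?_
    have hV := (sqAddProd_pos (by positivity : 0 ≤ 4 * z ^ 2) m).ne'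
    have p1 : ((m : ℝ) + 1) ^ 2 + 4 * z ^ 2 ≠ 0 := by positivity
    have p2 : (m : ℝ) + 1 ≠ 0 := by positivity
    simp only [wpCert, add_zero, sqAddProd_succ, Nat.descFactorial_zero]
    field_simp
    push_cast
    ring
  rw [s1.tsum_add s0, tsum_mul_left, tsum_mul_left] at h
  rw [wpSum, wpSum, h]
  have : 1 + 4 * z ^ 2 ≠ 0 := by positivity
  simp only [wpCert, sqAddProd_succ, sqAddProd_zero_right, zero_add]
  norm_num
  field_simp
  ring

theorem wpTerm_self_pos {x y : ℝ} (hx : 0 ≤ x) (hy : 0 ≤ y) (n : ℕ) : 0 < wpTerm x y n n := by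
  have h1 := sqAddProd_pos hx n
  have h2 := sqAddProd_pos hy (n + n + 1)
  have h3 : 0 < n.descFactorial n := by rw [Nat.descFactorial_self]; positivity
  unfold wpTerm
  positivity

theorem wpSum_pos {x y : ℝ} (hx : 0 ≤ x) (hxy : x ≤ y) (n : ℕ) : 0 < wpSum x y n :=
  (summable_wpTerm hx hxy n).tsum_pos (wpTerm_nonneg hx (hx.trans hxy) n) n
    (wpTerm_self_pos hx (hx.trans hxy) n)

theorem wpTerm_eq_mul {x y : ℝ} (n m : ℕ) :
    wpTerm x y n m = sqAddProd x m / (m.factorial : ℝ) ^ 2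
      / (sqAddProd y (m + n + 1) / ((m + n + 1).factorial : ℝ) ^ 2) * wpTerm 0 0 n m := by
  unfold wpTerm
  rw [sqAddProd_zero_left, sqAddProd_zero_left]
  field_simp

theorem tendsto_wpSum_div {x y A B : ℝ} (hx : 0 ≤ x) (hxy : x ≤ y) (hB : B ≠ 0)
    (hA' : Tendsto (fun m : ℕ => sqAddProd x m / (m.factorial : ℝ) ^ 2) atTop (nhds A))
    (hB' : Tendsto (fun m : ℕ => sqAddProd y m / (m.factorial : ℝ) ^ 2) atTop (nhds B)) :
    Tendsto (fun n => wpSum x y n / wpSum 0 0 n) atTop (nhds (A / B)) := by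
  have hprod := (hA'.comp (tendsto_fst (f := atTop) (g := (atTop : Filter ℕ)))).div
    (hB'.comp (tendsto_snd (f := (atTop : Filter ℕ)) (g := atTop))) hB
  rw [Metric.tendsto_atTop]
  intro ε hε
  have hev := (Metric.tendsto_nhds.1 hprod) (ε / 2) (by positivity)
  rw [prod_atTop_atTop_eq, eventually_atTop] at hev
  obtain ⟨⟨N₁, N₂⟩, hN⟩ := hev
  refine ⟨max N₁ N₂, fun n hn => ?_⟩
  have hn1 : N₁ ≤ n := (le_max_left _ _).trans hn
  have hn2 : N₂ ≤ n := (le_max_right _ _).trans hn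
  have s0 := summable_wpTerm le_rfl (le_refl (0 : ℝ)) n
  have s1 := summable_wpTerm hx hxy n
  have hpos : 0 < wpSum 0 0 n := wpSum_pos le_rfl le_rfl n
  have hterm : ∀ m, |wpTerm x y n m - A / B * wpTerm 0 0 n m| ≤ ε / 2 * wpTerm 0 0 n m := by
    intro m
    rcases lt_or_ge m n with h | h
    · simp [wpTerm, Nat.descFactorial_of_lt h]
    · have h1 := hN (m, m + n + 1) ⟨hn1.trans h, by change N₂ ≤ m + n + 1; omega⟩
      simp only [Pi.div_apply, Function.comp, Real.dist_eq] at h1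
      rw [wpTerm_eq_mul, ← sub_mul, abs_mul, abs_of_nonneg (wpTerm_nonneg le_rfl le_rfl n m)]
      exact mul_le_mul_of_nonneg_right h1.le (wpTerm_nonneg le_rfl le_rfl n m)
  have hs : |wpSum x y n - A / B * wpSum 0 0 n| ≤ ε / 2 * wpSum 0 0 n := by
    rw [wpSum, wpSum, ← tsum_mul_left, ← tsum_mul_left, ← s1.tsum_sub (s0.mul_left _)]
    exact tsum_of_norm_bounded (f := fun m => wpTerm x y n m - A / B * wpTerm 0 0 n m)
      (s0.mul_left (ε / 2)).hasSum hterm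
  rw [Real.dist_eq]
  have : wpSum x y n / wpSum 0 0 n - A / B
      = (wpSum x y n - A / B * wpSum 0 0 n) / wpSum 0 0 n := by field_simp
  rw [this, abs_div, abs_of_pos hpos, div_lt_iff₀ hpos]
  nlinarith

theorem tendsto_zero_of_le_mul_add {y e : ℕ → ℝ} {ρ : ℝ} (hρ0 : 0 ≤ ρ) (hρ : ρ < 1)
    (h : ∀ n, |y (n + 1)| ≤ ρ * |y n| + e n) (he : Tendsto e atTop (nhds 0)) :
    Tendsto y atTop (nhds 0) := by
  rw [Metric.tendsto_atTop]
  intro ε hε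
  obtain ⟨N, hN⟩ := eventually_atTop.1
    (he.eventually (gt_mem_nhds (show (0 : ℝ) < ε / 2 * (1 - ρ) by
      have : 0 < 1 - ρ := by linarith
      positivity)))
  have key : ∀ k, |y (N + k)| ≤ ρ ^ k * |y N| + ε / 2 := by
    intro k
    induction k with
    | zero => simp; linarith
    | succ k ih =>
      have h1 := h (N + k)
      have h2 := hN (N + k) (by omega)
      have h3 := mul_le_mul_of_nonneg_left ih hρ0
      rw [← add_assoc, pow_succ]
      nlinarith
  have hp : Tendsto (fun k => ρ ^ k * |y N|) atTop (nhds 0) := by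
    simpa using (tendsto_pow_atTop_nhds_zero_of_lt_one hρ0 hρ).mul_const (|y N|)
  obtain ⟨K, hK⟩ := eventually_atTop.1 (hp.eventually (gt_mem_nhds (half_pos hε)))
  refine ⟨N + K, fun n hn => ?_⟩
  have h1 := key (n - N)
  have h2 := hK (n - N) (by omega)
  rw [Nat.add_sub_cancel' (by omega)] at h1
  rw [Real.dist_eq, sub_zero]
  linarith

theorem tendsto_of_add_mul_tendsto {u : ℕ → ℝ} {ρ D : ℝ} (hρ0 : 0 ≤ ρ) (hρ : ρ < 1)
    (h : Tendsto (fun n => u (n + 1) + ρ * u n) atTop (nhds D)) :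
    Tendsto u atTop (nhds (D / (1 + ρ))) := by
  have h1 : (1 + ρ) ≠ 0 := by positivity
  rw [← tendsto_sub_nhds_zero_iff]
  refine tendsto_zero_of_le_mul_add hρ0 hρ (e := fun n => |u (n + 1) + ρ * u n - D|)
    (fun n => ?_) ?_
  · have : u (n + 1) - D / (1 + ρ)
        = -(ρ * (u n - D / (1 + ρ))) + (u (n + 1) + ρ * u n - D) := by
      field_simp
      ring
    rw [this]
    refine (abs_add_le _ _).trans ?_
    rw [abs_neg, abs_mul, abs_of_nonneg hρ0]
  · simpa using (tendsto_sub_nhds_zero_iff.2 h).abs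

theorem integral_pow_mul_one_sub_pow (m n : ℕ) :
    ∫ x in (0 : ℝ)..1, x ^ m * (1 - x) ^ n
      = (m.factorial : ℝ) * n.factorial / (m + n + 1).factorial := by
  induction n generalizing m with
  | zero =>
    simp only [pow_zero, mul_one, integral_pow, add_zero, Nat.factorial_succ, Nat.factorial_zero]
    have : (m.factorial : ℝ) ≠ 0 := by positivity
    push_cast
    field_simp
    simp
  | succ n ih =>
    have hd : ∀ x : ℝ, HasDerivAt (fun x : ℝ => x ^ (m + 1) * (1 - x) ^ (n + 1))
        (((m : ℝ) + 1) * (x ^ m * (1 - x) ^ (n + 1))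
          - ((n : ℝ) + 1) * (x ^ (m + 1) * (1 - x) ^ n)) x := by
      intro x
      have h1 := hasDerivAt_pow (m + 1) x
      have h2 := ((hasDerivAt_id x).const_sub 1).pow (n + 1)
      refine HasDerivAt.congr_deriv (h1.mul h2) ?_
      simp
      ring
    have hi := intervalIntegral.integral_eq_sub_of_hasDerivAt (a := 0) (b := 1)
      (fun x _ => hd x) (Continuous.intervalIntegrable (by fun_prop) _ _)
    rw [intervalIntegral.integral_sub (Continuous.intervalIntegrable (by fun_prop) _ _)
      (Continuous.intervalIntegrable (by fun_prop) _ _), intervalIntegral.integral_const_mul,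
      intervalIntegral.integral_const_mul, ih (m + 1)] at hi
    simp only [sub_self, ne_eq, Nat.succ_ne_zero, not_false_eq_true, zero_pow, mul_zero,
      zero_mul] at hi
    have e : m + 1 + n + 1 = m + (n + 1) + 1 := by ring
    rw [e] at hi
    have hm : (m : ℝ) + 1 ≠ 0 := by positivity
    refine mul_left_cancel₀ hm ?_
    rw [Nat.factorial_succ m] at hi
    rw [Nat.factorial_succ n]
    push_cast at hi ⊢
    linear_combination hi

/-- The unit square. -/
def unitSquare : Set (ℝ × ℝ) := Set.Ioo 0 1 ×ˢ Set.Ioo 0 1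

/-- The integrand of Beukers' double integral for `ζ(2)`. -/
noncomputable def beukersIntegrand (n : ℕ) (p : ℝ × ℝ) : ℝ :=
  (p.1 * (1 - p.1) * p.2 * (1 - p.2) / (1 - p.1 * p.2)) ^ n / (1 - p.1 * p.2)

theorem mul_lt_one_of_mem_unitSquare {p : ℝ × ℝ} (hp : p ∈ unitSquare) : p.1 * p.2 < 1 := by
  obtain ⟨⟨h1, h2⟩, h3, h4⟩ := hp
  nlinarith

theorem setIntegral_unitSquare_mul (f g : ℝ → ℝ) :
    ∫ p in unitSquare, f p.1 * g p.2 = (∫ x in (0 : ℝ)..1, f x) * ∫ x in (0 : ℝ)..1, g x := by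
  rw [intervalIntegral.integral_of_le zero_le_one, intervalIntegral.integral_of_le zero_le_one,
    MeasureTheory.integral_Ioc_eq_integral_Ioo, MeasureTheory.integral_Ioc_eq_integral_Ioo,
    unitSquare, MeasureTheory.Measure.volume_eq_prod]
  exact MeasureTheory.setIntegral_prod_mul f g _ _

theorem integral_beukersIntegrand (n : ℕ) :
    ∫ p in unitSquare, beukersIntegrand n p = n.factorial * wpSum 0 0 n := by
  set f : ℕ → ℝ → ℝ := fun k x => x ^ (k + n) * (1 - x) ^ n with hf
  set T : ℕ → ℝ × ℝ → ℝ := fun k p => ((k + n).choose n : ℝ) * (f k p.1 * f k p.2) with hT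
  have hmeas : MeasurableSet unitSquare := measurableSet_Ioo.prod measurableSet_Ioo
  have hint : ∀ k, ∫ p in unitSquare, T k p = n.factorial * wpTerm 0 0 n (k + n) := by
    intro k
    rw [hT, MeasureTheory.integral_const_mul, setIntegral_unitSquare_mul, hf,
      integral_pow_mul_one_sub_pow, wpTerm, sqAddProd_zero_left, sqAddProd_zero_left,
      Nat.descFactorial_eq_factorial_mul_choose]
    push_cast
    field_simp
  have hnonneg : ∀ k, ∀ p ∈ unitSquare, 0 ≤ T k p := by
    rintro k p ⟨⟨h1, h2⟩, h3, h4⟩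
    have h5 : 0 ≤ 1 - p.1 := by linarith
    have h6 : 0 ≤ 1 - p.2 := by linarith
    simp only [hT, hf]
    positivity
  have hnorm : ∀ k, ∫ p in unitSquare, ‖T k p‖ = ∫ p in unitSquare, T k p := fun k =>
    MeasureTheory.setIntegral_congr_fun hmeas fun p hp => Real.norm_of_nonneg (hnonneg k p hp)
  have hsum : Summable fun k => wpTerm 0 0 n (k + n) :=
    (summable_nat_add_iff n).2 (summable_wpTerm le_rfl le_rfl n)
  have hinteg : ∀ k, MeasureTheory.Integrable (T k) (MeasureTheory.volume.restrict unitSquare) := by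
    intro k
    have hc : Continuous (T k) := by fun_prop
    have hK : IsCompact (Set.Icc (0 : ℝ) 1 ×ˢ Set.Icc (0 : ℝ) 1) := isCompact_Icc.prod isCompact_Icc
    exact (hc.continuousOn.integrableOn_compact hK).mono_set
      (Set.prod_mono Set.Ioo_subset_Icc_self Set.Ioo_subset_Icc_self)
  have h := MeasureTheory.hasSum_integral_of_summable_integral_norm hinteg (by
    simp only [hnorm, hint]
    exact hsum.mul_left _)
  simp only [hint] at h
  have hts : ∀ p ∈ unitSquare, beukersIntegrand n p = ∑' k, T k p := by
    intro p hp
    have hlt := mul_lt_one_of_mem_unitSquare hp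
    obtain ⟨⟨h1, h2⟩, h3, h4⟩ := hp
    have hn : ‖p.1 * p.2‖ < 1 := by rwa [Real.norm_of_nonneg (by positivity)]
    have hg := (hasSum_choose_mul_geometric_of_norm_lt_one n hn).mul_left
      ((p.1 * p.2) ^ n * ((1 - p.1) * (1 - p.2)) ^ n)
    have hT' : (fun k => T k p) = fun k => (p.1 * p.2) ^ n * ((1 - p.1) * (1 - p.2)) ^ n
        * (((k + n).choose n : ℝ) * (p.1 * p.2) ^ k) := by
      funext k
      simp only [hT, hf, mul_pow, pow_add]
      ring
    rw [hT', hg.tsum_eq, beukersIntegrand, div_pow, pow_succ]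
    have : 1 - p.1 * p.2 ≠ 0 := by linarith
    simp only [mul_pow]
    field_simp
  rw [MeasureTheory.setIntegral_congr_fun hmeas hts, ← h.tsum_eq, tsum_mul_left, wpSum,
    ← (summable_wpTerm le_rfl le_rfl n).sum_add_tsum_nat_add n, Finset.sum_eq_zero, zero_add]
  intro m hm
  rw [wpTerm, Nat.descFactorial_of_lt (Finset.mem_range.1 hm)]
  simp

theorem integrable_exp_neg_quadratic {b c : ℝ} (hb : 0 < b) (hc : |c| ≤ 1) :
    MeasureTheory.Integrable fun p : ℝ × ℝ =>
      rexp (-b * (p.1 ^ 2 + p.2 ^ 2 - c * p.1 * p.2)) := by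
  have h := (integrable_exp_neg_mul_sq (half_pos hb)).mul_prod
    (integrable_exp_neg_mul_sq (half_pos hb))
  refine h.mono' (Continuous.aestronglyMeasurable (by fun_prop)) (.of_forall fun p => ?_)
  rw [Real.norm_of_nonneg (exp_pos _).le, ← Real.exp_add]
  refine Real.exp_le_exp.2 ?_
  obtain ⟨h1, h2⟩ := abs_le.1 hc
  have : 0 ≤ b * ((1 - c) * (p.1 + p.2) ^ 2 + (1 + c) * (p.1 - p.2) ^ 2) := by
    have := sub_nonneg.2 h2
    have : 0 ≤ 1 + c := by linarith
    positivity
  nlinarith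

theorem integral_exp_neg_quadratic {b c : ℝ} (hb : 0 < b) (hc : |c| ≤ 1) :
    ∫ p : ℝ × ℝ, rexp (-b * (p.1 ^ 2 + p.2 ^ 2 - c * p.1 * p.2)) = π / (b * √(1 - c ^ 2 / 4)) := by
  have hc' : 0 < 1 - c ^ 2 / 4 := by
    have := sq_le_one_iff_abs_le_one c |>.2 hc
    linarith
  rw [MeasureTheory.Measure.volume_eq_prod, MeasureTheory.integral_prod _
    (integrable_exp_neg_quadratic hb hc)]
  have inner : ∀ u : ℝ, ∫ w : ℝ, rexp (-b * (u ^ 2 + w ^ 2 - c * u * w))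
      = rexp (-(b * (1 - c ^ 2 / 4)) * u ^ 2) * √(π / b) := by
    intro u
    rw [← integral_gaussian b, ← MeasureTheory.integral_sub_right_eq_self
      (fun w : ℝ => rexp (-b * w ^ 2)) (c / 2 * u), ← MeasureTheory.integral_const_mul]
    refine MeasureTheory.integral_congr_ae (.of_forall fun w => ?_)
    simp only [← Real.exp_add]
    ring_nf
  simp only [inner]
  rw [MeasureTheory.integral_mul_const, integral_gaussian, ← Real.sqrt_mul (by positivity)]
  have : π / (b * (1 - c ^ 2 / 4)) * (π / b) = (π / (b * √(1 - c ^ 2 / 4))) ^ 2 := by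
    rw [div_pow, mul_pow, Real.sq_sqrt hc'.le]
    field_simp
  rw [this, Real.sqrt_sq (by positivity)]

theorem beukers_quadratic_bound {a x y : ℝ} (ha0 : 0 < a) (ha : a ^ 2 = 1 - a)
    (hx : 0 < x) (hx1 : x < 1) (hy : 0 < y) (hy1 : y < 1) :
    x * (1 - x) * y * (1 - y)
      ≤ a ^ 5 * (1 - x * y) * (1 - ((x - a) ^ 2 + (y - a) ^ 2) / 8) := by
  have ha1 : (618 : ℝ) / 1000 < a := by nlinarith
  have ha2 : a < (619 : ℝ) / 1000 := by nlinarith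
  have ha3 : a ^ 3 = 2 * a - 1 := by linear_combination (a - 1) * ha
  have ha5 : a ^ 5 = 5 * a - 3 := by linear_combination (a ^ 3 - a ^ 2 + 2 * a - 3) * ha
  obtain ⟨v, hv0, hv⟩ : ∃ v : ℝ, 0 < v ∧ v ^ 2 = x * y :=
    ⟨√(x * y), Real.sqrt_pos.2 (by positivity), Real.sq_sqrt (by positivity)⟩
  have hv1 : v < 1 := by nlinarith
  have hd : 0 ≤ x + y - 2 * v := by
    have : 2 * v ≤ x + y := le_of_sq_le_sq (by nlinarith [sq_nonneg (x - y)]) (by linarith)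
    linarith
  have hd1 : x + y - 2 * v ≤ (1 - v) ^ 2 := by
    have := mul_pos (sub_pos.2 hx1) (sub_pos.2 hy1)
    linarith
  have hxy : x * (1 - x) * y * (1 - y) = v ^ 2 * (1 - 2 * v + v ^ 2 - (x + y - 2 * v)) := by
    linear_combination (-1 + x + y - x * y - v ^ 2) * hv
  have hQ : (x - a) ^ 2 + (y - a) ^ 2 = (x + y - 2 * v + 2 * (v - a)) ^ 2 / 2
      + (x + y - 2 * v) * (x + y - 2 * v + 4 * v) / 2 := by
    linear_combination 2 * hv
  have hq1 : (x - a) ^ 2 + (y - a) ^ 2 ≤ 1 := by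
    have h1 : 0 ≤ x * (2 * a - x) := mul_nonneg hx.le (by linarith)
    have h2 : 0 ≤ y * (2 * a - y) := mul_nonneg hy.le (by linarith)
    linarith
  have hQ0 : 0 ≤ (x - a) ^ 2 + (y - a) ^ 2 := by positivity
  have h1v : 0 ≤ 1 - v ^ 2 := by nlinarith
  generalize (x - a) ^ 2 + (y - a) ^ 2 = Q at *
  rw [← hv, hxy]
  generalize x + y - 2 * v = d at *
  have hq : Q ≤ 4 * d + 4 * (v - a) ^ 2 := by
    have h1 : d * d ≤ d * (1 - v) ^ 2 := mul_le_mul_of_nonneg_left hd1 hd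
    have h2 : 0 ≤ d * (v * (1 - v)) := mul_nonneg hd (mul_nonneg hv0.le (by linarith))
    have h3 : 0 ≤ (d - 2 * (v - a)) ^ 2 := sq_nonneg _
    have h4 : 0 ≤ d * v ^ 2 := by positivity
    have h5 : 0 ≤ d * (1 - v) := mul_nonneg hd (by linarith)
    linarith
  have hid : a ^ 5 * (1 - v ^ 2) - v ^ 2 * (1 - 2 * v + v ^ 2 - d)
      = (1 - v) * (v - a) ^ 2 * (v + a ^ 3) + v ^ 2 * d := by
    rw [ha5, ha3]
    linear_combination (1 - v) * (3 * v - 2 * a + 3) * ha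
  have hA : (1 - v ^ 2) * ((v - a) ^ 2 / 5) ≤ (1 - v) * (v - a) ^ 2 * (v + a ^ 3) := by
    have h1 : 0 ≤ (1 - v) * (v - a) ^ 2 := mul_nonneg (by linarith) (sq_nonneg _)
    have h2 : (1 + v) / 5 ≤ v + a ^ 3 := by linarith
    linarith [mul_le_mul_of_nonneg_left h2 h1]
  have hmain : (1 - v ^ 2) * (Q / 64) ≤ (1 - v ^ 2) * ((v - a) ^ 2 / 5) + v ^ 2 * d := by
    rcases le_or_gt (1 / 4) v with h | h
    · have h2 : 1 / 16 * d ≤ v ^ 2 * d := mul_le_mul_of_nonneg_right (by nlinarith only [h]) hd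
      have h3 : (1 - v ^ 2) * (Q / 64) ≤ (1 - v ^ 2) * (d / 16 + (v - a) ^ 2 / 5) :=
        mul_le_mul_of_nonneg_left (by linarith [sq_nonneg (v - a)]) h1v
      have h4 : 0 ≤ v ^ 2 * (d / 16) := by positivity
      linarith
    · have h2 : 5 / 64 ≤ (v - a) ^ 2 := by nlinarith only [h, ha1]
      have h3 : (1 - v ^ 2) * (Q / 64) ≤ (1 - v ^ 2) * ((v - a) ^ 2 / 5) :=
        mul_le_mul_of_nonneg_left (by linarith) h1v
      have : 0 ≤ v ^ 2 * d := by positivity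
      linarith
  have h8 : a ^ 5 * ((1 - v ^ 2) * (Q / 8)) ≤ 1 / 8 * ((1 - v ^ 2) * (Q / 8)) :=
    mul_le_mul_of_nonneg_right (by linarith) (by positivity)
  linarith

theorem beukersIntegrand_nonneg (n : ℕ) {p : ℝ × ℝ} (hp : p ∈ unitSquare) :
    0 ≤ beukersIntegrand n p := by
  have h := sub_pos.2 (mul_lt_one_of_mem_unitSquare hp)
  obtain ⟨⟨h1, h2⟩, h3, h4⟩ := hp
  have h5 := sub_pos.2 h2
  have h6 := sub_pos.2 h4
  unfold beukersIntegrand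
  positivity

theorem beukersIntegrand_succ_le {a : ℝ} (ha0 : 0 < a) (ha : a ^ 2 = 1 - a) (n : ℕ)
    {p : ℝ × ℝ} (hp : p ∈ unitSquare) :
    beukersIntegrand (n + 1) p
      ≤ (a ^ 5) ^ n * rexp (-(n * ((p.1 - a) ^ 2 + (p.2 - a) ^ 2) / 8)) := by
  have h := sub_pos.2 (mul_lt_one_of_mem_unitSquare hp)
  obtain ⟨⟨h1, h2⟩, h3, h4⟩ := hp
  have hb := beukers_quadratic_bound ha0 ha h1 h2 h3 h4
  have h5 := sub_pos.2 h2
  have h6 := sub_pos.2 h4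
  set Q := (p.1 - a) ^ 2 + (p.2 - a) ^ 2
  have hf : p.1 * (1 - p.1) * p.2 * (1 - p.2) / (1 - p.1 * p.2) ≤ a ^ 5 * rexp (-(Q / 8)) := by
    rw [div_le_iff₀ h]
    have := mul_le_mul_of_nonneg_left (Real.add_one_le_exp (-(Q / 8)))
      (by positivity : 0 ≤ a ^ 5 * (1 - p.1 * p.2))
    linarith
  have hg : p.1 * (1 - p.1) * p.2 * (1 - p.2) / (1 - p.1 * p.2) / (1 - p.1 * p.2) ≤ 1 := by
    rw [div_div, div_le_one (by positivity)]
    have e1 : p.1 * (1 - p.1) ≤ 1 - p.1 * p.2 := by nlinarith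
    have e2 : p.2 * (1 - p.2) ≤ 1 - p.1 * p.2 := by nlinarith
    have := mul_le_mul e1 e2 (by positivity) h.le
    linarith
  have hexp : rexp (-(n * Q / 8)) = rexp (-(Q / 8)) ^ n := by
    rw [← Real.exp_nat_mul]
    congr 1
    ring
  rw [beukersIntegrand, pow_succ, mul_div_assoc, hexp, ← mul_pow]
  calc _ ≤ (a ^ 5 * rexp (-(Q / 8))) ^ n * 1 := by gcongr
    _ = _ := mul_one _

theorem tendsto_beukersIntegrand_scaled {a : ℝ} (ha0 : 0 < a) (ha : a ^ 2 = 1 - a)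
    (p : ℝ × ℝ) :
    Tendsto (fun n : ℕ => beukersIntegrand n ((a, a) + (√n)⁻¹ • p) / (a ^ 5) ^ n) atTop
      (nhds (rexp (-(1 / a ^ 3) * (p.1 ^ 2 + p.2 ^ 2 - a * p.1 * p.2)) / a)) := by
  have hr : Tendsto (fun n : ℕ => (√(n : ℝ))⁻¹) atTop (nhds 0) :=
    (Real.tendsto_sqrt_atTop.comp tendsto_natCast_atTop_atTop).inv_tendsto_atTop
  have hden : Tendsto (fun n : ℕ => 1 - (a + (√(n : ℝ))⁻¹ * p.1) * (a + (√(n : ℝ))⁻¹ * p.2))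
      atTop (nhds a) := by
    have := ((hr.mul_const p.1).const_add a).mul ((hr.mul_const p.2).const_add a)
    have := this.const_sub 1
    convert this using 2
    linear_combination ha
  have hden0 := hden.eventually_ne ha0.ne'
  set δ : ℕ → ℝ := fun n =>
    (a + (√(n : ℝ))⁻¹ * p.1) * (1 - (a + (√(n : ℝ))⁻¹ * p.1)) * (a + (√(n : ℝ))⁻¹ * p.2)
      * (1 - (a + (√(n : ℝ))⁻¹ * p.2))
      / (1 - (a + (√(n : ℝ))⁻¹ * p.1) * (a + (√(n : ℝ))⁻¹ * p.2)) / a ^ 5 - 1 with hδ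
  have hδt : Tendsto (fun n : ℕ => n * δ n) atTop
      (nhds (-(1 / a ^ 3) * (p.1 ^ 2 + p.2 ^ 2 - a * p.1 * p.2))) := by
    have hnum : Tendsto (fun n : ℕ => -(a ^ 3 * (p.1 ^ 2 + p.2 ^ 2) - a ^ 4 * p.1 * p.2
        - a ^ 3 * p.1 * p.2 * (p.1 + p.2) * (√(n : ℝ))⁻¹ - p.1 ^ 2 * p.2 ^ 2 * (√(n : ℝ))⁻¹ ^ 2)
        / a ^ 5) atTop (nhds (-(a ^ 3 * (p.1 ^ 2 + p.2 ^ 2) - a ^ 4 * p.1 * p.2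
        - a ^ 3 * p.1 * p.2 * (p.1 + p.2) * 0 - p.1 ^ 2 * p.2 ^ 2 * 0 ^ 2) / a ^ 5)) := by
      have h1 := hr.const_mul (a ^ 3 * p.1 * p.2 * (p.1 + p.2))
      have h2 := (hr.pow 2).const_mul (p.1 ^ 2 * p.2 ^ 2)
      exact ((h1.const_sub _).sub h2).neg.div_const _
    have hlim := hnum.div hden ha0.ne'
    have e : -(a ^ 3 * (p.1 ^ 2 + p.2 ^ 2) - a ^ 4 * p.1 * p.2
        - a ^ 3 * p.1 * p.2 * (p.1 + p.2) * 0 - p.1 ^ 2 * p.2 ^ 2 * 0 ^ 2) / a ^ 5 / a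
        = -(1 / a ^ 3) * (p.1 ^ 2 + p.2 ^ 2 - a * p.1 * p.2) := by
      field_simp
      ring
    rw [e] at hlim
    refine hlim.congr' ?_
    filter_upwards [hden0, eventually_gt_atTop 0] with n hn hn0
    have hn0' : (0 : ℝ) < n := by exact_mod_cast hn0
    have hs : (n : ℝ) * (√(n : ℝ))⁻¹ ^ 2 = 1 := by
      rw [inv_pow, Real.sq_sqrt hn0'.le, mul_inv_cancel₀ hn0'.ne']
    simp only [Pi.div_apply, hδ]
    generalize (√(n : ℝ))⁻¹ = r at *
    have hid : (a + r * p.1) * (1 - (a + r * p.1)) * (a + r * p.2) * (1 - (a + r * p.2))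
        = a ^ 5 * (1 - (a + r * p.1) * (a + r * p.2))
        - r ^ 2 * (a ^ 3 * (p.1 ^ 2 + p.2 ^ 2) - a ^ 4 * p.1 * p.2
        - a ^ 3 * p.1 * p.2 * (p.1 + p.2) * r - p.1 ^ 2 * p.2 ^ 2 * r ^ 2) := by
      have ha3 : a ^ 3 = 2 * a - 1 := by linear_combination (a - 1) * ha
      have e : ∀ h : ℝ, (a + h) * (1 - (a + h)) = a ^ 3 - a ^ 3 * h - h ^ 2 := fun h => by
        rw [ha3]
        linear_combination -ha
      linear_combination (a + r * p.2) * (1 - (a + r * p.2)) * e (r * p.1)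
        + (a ^ 3 - a ^ 3 * (r * p.1) - (r * p.1) ^ 2) * e (r * p.2)
        + (a ^ 5 + a ^ 4 * (r * p.1) * (r * p.2)) * ha
    rw [hid]
    generalize 1 - (a + r * p.1) * (a + r * p.2) = D at hn ⊢
    field_simp
    linear_combination (a ^ 3 * (p.1 ^ 2 + p.2 ^ 2) - a ^ 4 * p.1 * p.2
        - a ^ 3 * p.1 * p.2 * (p.1 + p.2) * r - p.1 ^ 2 * p.2 ^ 2 * r ^ 2) * hs
  have hexp := Real.tendsto_one_add_pow_exp_of_tendsto hδt
  refine (hexp.div hden ha0.ne').congr fun n => ?_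
  simp only [Pi.div_apply, hδ, beukersIntegrand, Prod.fst_add, Prod.snd_add, Prod.smul_fst,
    Prod.smul_snd, smul_eq_mul, add_sub_cancel, div_pow]
  ring

theorem measurable_indicator_beukersIntegrand (n : ℕ) :
    Measurable (unitSquare.indicator (beukersIntegrand n)) := by
  refine Measurable.indicator ?_ (measurableSet_Ioo.prod measurableSet_Ioo)
  unfold beukersIntegrand
  fun_prop

theorem integral_scaled (n : ℕ) (c : ℝ × ℝ) (G : ℝ × ℝ → ℝ) :
    ∫ p : ℝ × ℝ, G (c + (√n)⁻¹ • p) = n * ∫ p : ℝ × ℝ, G p := by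
  have h := MeasureTheory.Measure.integral_comp_smul
    (MeasureTheory.volume : MeasureTheory.Measure (ℝ × ℝ)) (fun p => G (c + p)) (√(n : ℝ))⁻¹
  rw [h, MeasureTheory.integral_add_left_eq_self]
  simp

theorem tendsto_factorial_mul_wpSum_zero {a : ℝ} (ha0 : 0 < a) (ha : a ^ 2 = 1 - a) :
    Tendsto (fun n : ℕ => (n : ℝ) * (n.factorial * wpSum 0 0 n) / (a ^ 5) ^ n) atTop
      (nhds (π * a ^ 2 / √(1 - a ^ 2 / 4))) := by
  have ha1 : a < 1 := by nlinarith
  have hunit : MeasurableSet unitSquare := measurableSet_Ioo.prod measurableSet_Ioo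
  have hval : ∫ p : ℝ × ℝ, rexp (-(1 / a ^ 3) * (p.1 ^ 2 + p.2 ^ 2 - a * p.1 * p.2)) / a
      = π * a ^ 2 / √(1 - a ^ 2 / 4) := by
    rw [MeasureTheory.integral_div, integral_exp_neg_quadratic (by positivity)
      (by rw [abs_of_pos ha0]; exact ha1.le)]
    field_simp
  rw [← hval]
  have hbound : MeasureTheory.Integrable fun p : ℝ × ℝ =>
      rexp (-(1 / 16) * (p.1 ^ 2 + p.2 ^ 2 - 0 * p.1 * p.2)) / a ^ 5 :=
    (integrable_exp_neg_quadratic (by norm_num) (by simp)).div_const _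
  have key := MeasureTheory.tendsto_integral_filter_of_dominated_convergence (l := atTop)
    (F := fun (n : ℕ) (p : ℝ × ℝ) =>
      unitSquare.indicator (beukersIntegrand n) ((a, a) + (√(n : ℝ))⁻¹ • p) / (a ^ 5) ^ n)
    (f := fun p : ℝ × ℝ => rexp (-(1 / a ^ 3) * (p.1 ^ 2 + p.2 ^ 2 - a * p.1 * p.2)) / a)
    _ (.of_forall fun n => ?_) ?_ hbound (.of_forall fun p => ?_)
  · refine key.congr fun n => ?_
    rw [MeasureTheory.integral_div, integral_scaled, MeasureTheory.integral_indicator hunit,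
      integral_beukersIntegrand]
  · exact (((measurable_indicator_beukersIntegrand n).comp (by fun_prop)).div_const
      _).aestronglyMeasurable
  · filter_upwards [eventually_ge_atTop 2] with n hn
    refine .of_forall fun p => ?_
    by_cases hp : (a, a) + (√(n : ℝ))⁻¹ • p ∈ unitSquare
    · rw [Set.indicator_of_mem hp, Real.norm_of_nonneg
        (div_nonneg (beukersIntegrand_nonneg n hp) (by positivity))]
      obtain ⟨m, rfl⟩ : ∃ m, n = m + 1 := ⟨n - 1, by omega⟩
      have hm : (1 : ℝ) ≤ m := by exact_mod_cast Nat.le_of_succ_le_succ hn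
      have h := beukersIntegrand_succ_le ha0 ha m hp
      rw [pow_succ (a ^ 5) m, ← div_div]
      refine div_le_div_of_nonneg_right ?_ (by positivity)
      rw [div_le_iff₀ (by positivity), mul_comm]
      refine h.trans (mul_le_mul_of_nonneg_left ?_ (by positivity))
      refine Real.exp_le_exp.2 ?_
      have hs : (√((m + 1 : ℕ) : ℝ))⁻¹ ^ 2 = 1 / (m + 1) := by
        rw [inv_pow, Real.sq_sqrt (by positivity)]
        simp
      simp only [Prod.fst_add, Prod.snd_add, Prod.smul_fst,
        Prod.smul_snd, smul_eq_mul, add_sub_cancel_left, mul_pow, hs]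
      have hm' : (1 : ℝ) / 2 ≤ m * (1 / (m + 1)) := by
        rw [mul_one_div, div_le_div_iff₀ (by positivity) (by positivity)]
        linarith
      have := mul_le_mul_of_nonneg_right hm' (by positivity : 0 ≤ p.1 ^ 2 + p.2 ^ 2)
      linarith
    · rw [Set.indicator_of_notMem hp]
      simp only [zero_div, norm_zero]
      positivity
  · have hmem : ∀ᶠ n : ℕ in atTop, (a, a) + (√(n : ℝ))⁻¹ • p ∈ unitSquare := by
      have hr : Tendsto (fun n : ℕ => (√(n : ℝ))⁻¹) atTop (nhds 0) :=
        (Real.tendsto_sqrt_atTop.comp tendsto_natCast_atTop_atTop).inv_tendsto_atTop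
      have ht := (hr.smul_const p).const_add (a, a)
      rw [zero_smul, add_zero] at ht
      exact ht.eventually ((isOpen_Ioo.prod isOpen_Ioo).mem_nhds ⟨⟨ha0, ha1⟩, ha0, ha1⟩)
    refine (tendsto_beukersIntegrand_scaled ha0 ha p).congr' ?_
    filter_upwards [hmem] with n hn
    rw [Set.indicator_of_mem hn]

theorem remainder_eq {z L : ℝ} (hz : z ≠ 0) {p q : ℕ → ℝ}
    (hL : L = (Real.cosh (π * z) - 1) / (3 * z ^ 2))
    (hp : ∀ n : ℕ, 2 ≤ n →
      p n = (11 * (n : ℝ) ^ 2 - 11 * (n : ℝ) + 3 + 9 * z ^ 2) * p (n - 1)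
              + (((n : ℝ) - 1) ^ 2 + 4 * z ^ 2) * (((n : ℝ) - 1) ^ 2 + 9 * z ^ 2) * p (n - 2))
    (hq : ∀ n : ℕ, 2 ≤ n →
      q n = (11 * (n : ℝ) ^ 2 - 11 * (n : ℝ) + 3 + 9 * z ^ 2) * q (n - 1)
              + (((n : ℝ) - 1) ^ 2 + 4 * z ^ 2) * (((n : ℝ) - 1) ^ 2 + 9 * z ^ 2) * q (n - 2))
    (hp0 : p 0 = 0) (hp1 : p 1 = 5) (hq0 : q 0 = 1) (hq1 : q 1 = 3 * (1 - z ^ 2)) (n : ℕ) :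
    L * q n - p n = (-1) ^ n * Real.cosh (π * z)
      * (sqAddProd (4 * z ^ 2) n * sqAddProd (9 * z ^ 2) n) / n.factorial
      * wpSum (z ^ 2) (4 * z ^ 2) n := by
  have hc := (Real.cosh_pos (π * z)).ne'
  induction n using Nat.twoStepInduction with
  | zero =>
    rw [wpSum_zero hz, hq0, hp0, hL]
    simp [sqAddProd_zero_right]
    field_simp
  | one =>
    have h1 := wpSum_one hz
    rw [wpSum_zero hz] at h1
    simp only [sqAddProd_succ, sqAddProd_zero_right, hq1, hp1, hL]
    have h2 : (1 + 4 * z ^ 2) * (1 + 9 * z ^ 2) * wpSum (z ^ 2) (4 * z ^ 2) 1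
      = 1 / Real.cosh (π * z) + 4
        - (3 + 9 * z ^ 2) * ((1 - 1 / Real.cosh (π * z)) / (3 * z ^ 2)) := by linarith
    have h3 : (-1 : ℝ) ^ 1 * Real.cosh (π * z) * (1 * (((0 : ℕ) + 1 : ℝ) ^ 2 + 4 * z ^ 2)
        * (1 * (((0 : ℕ) + 1 : ℝ) ^ 2 + 9 * z ^ 2))) / (Nat.factorial 1)
        * wpSum (z ^ 2) (4 * z ^ 2) 1
        = - Real.cosh (π * z) * ((1 + 4 * z ^ 2) * (1 + 9 * z ^ 2)
          * wpSum (z ^ 2) (4 * z ^ 2) 1) := by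
      simp
      ring
    rw [h3, h2]
    field_simp
    ring
  | more n ih0 ih1 =>
    have hx : 0 ≤ z ^ 2 := by positivity
    have hrec := wpSum_recurrence hx n
    have hp' := hp (n + 2) (by omega)
    have hq' := hq (n + 2) (by omega)
    simp only [Nat.add_sub_cancel, show n + 2 - 1 = n + 1 by omega] at hp' hq'
    have step : L * q (n + 2) - p (n + 2)
        = (11 * ((n : ℝ) + 2) ^ 2 - 11 * ((n : ℝ) + 2) + 3 + 9 * z ^ 2)
            * (L * q (n + 1) - p (n + 1))
          + (((n : ℝ) + 1) ^ 2 + 4 * z ^ 2) * (((n : ℝ) + 1) ^ 2 + 9 * z ^ 2)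
            * (L * q n - p n) := by
      rw [hp', hq']
      push_cast
      ring
    rw [step, ih0, ih1, sqAddProd_succ _ (n + 1), sqAddProd_succ _ (n + 1),
      sqAddProd_succ _ n, sqAddProd_succ _ n, Nat.factorial_succ (n + 1), Nat.factorial_succ n]
    push_cast
    have hn1 : (n : ℝ) + 1 ≠ 0 := by positivity
    have hn2 : (n : ℝ) + 2 ≠ 0 := by positivity
    have hf : (n.factorial : ℝ) ≠ 0 := by positivity
    rw [show (n : ℝ) + 1 + 1 = n + 2 by ring]
    linear_combination (norm := skip) (-((-1) ^ n * Real.cosh (π * z)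
      * (sqAddProd (4 * z ^ 2) n * sqAddProd (9 * z ^ 2) n)
      * ((((n : ℝ) + 1) ^ 2 + 4 * z ^ 2) * (((n : ℝ) + 1) ^ 2 + 9 * z ^ 2))
      / (((n : ℝ) + 2) * ((n : ℝ) + 1) * n.factorial))) * hrec
    generalize sqAddProd (4 * z ^ 2) n = S, sqAddProd (9 * z ^ 2) n = T,
      wpSum (z ^ 2) (4 * z ^ 2) n = s₀, wpSum (z ^ 2) (4 * z ^ 2) (n + 1) = s₁,
      wpSum (z ^ 2) (4 * z ^ 2) (n + 2) = s₂
    field_simp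
    ring

theorem casoratian_eq {z : ℝ} {p q : ℕ → ℝ}
    (hp : ∀ n : ℕ, 2 ≤ n →
      p n = (11 * (n : ℝ) ^ 2 - 11 * (n : ℝ) + 3 + 9 * z ^ 2) * p (n - 1)
              + (((n : ℝ) - 1) ^ 2 + 4 * z ^ 2) * (((n : ℝ) - 1) ^ 2 + 9 * z ^ 2) * p (n - 2))
    (hq : ∀ n : ℕ, 2 ≤ n →
      q n = (11 * (n : ℝ) ^ 2 - 11 * (n : ℝ) + 3 + 9 * z ^ 2) * q (n - 1)
              + (((n : ℝ) - 1) ^ 2 + 4 * z ^ 2) * (((n : ℝ) - 1) ^ 2 + 9 * z ^ 2) * q (n - 2))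
    (hp0 : p 0 = 0) (hp1 : p 1 = 5) (hq0 : q 0 = 1) (n : ℕ) :
    p (n + 1) * q n - p n * q (n + 1)
      = (-1) ^ n * 5 * (sqAddProd (4 * z ^ 2) n * sqAddProd (9 * z ^ 2) n) := by
  induction n with
  | zero => simp [hp0, hp1, hq0, sqAddProd_zero_right]
  | succ n ih =>
    have hp' := hp (n + 2) (by omega)
    have hq' := hq (n + 2) (by omega)
    simp only [Nat.add_sub_cancel, show n + 2 - 1 = n + 1 by omega] at hp' hq'
    rw [show n + 1 + 1 = n + 2 by omega, hp', hq', sqAddProd_succ, sqAddProd_succ]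
    push_cast
    linear_combination (-(((n : ℝ) + 1) ^ 2 + 4 * z ^ 2) * (((n : ℝ) + 1) ^ 2 + 9 * z ^ 2)) * ih

/-- The absolute value of the remainder `L * q n - p n` of the continued fraction. -/
noncomputable def absRemainder (z : ℝ) (n : ℕ) : ℝ :=
  Real.cosh (π * z) * (sqAddProd (4 * z ^ 2) n * sqAddProd (9 * z ^ 2) n) / n.factorial
    * wpSum (z ^ 2) (4 * z ^ 2) n

theorem absRemainder_pos (z : ℝ) (n : ℕ) : 0 < absRemainder z n := by
  have h1 := Real.cosh_pos (π * z)
  have h2 := sqAddProd_pos (by positivity : 0 ≤ 4 * z ^ 2) n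
  have h3 := sqAddProd_pos (by positivity : 0 ≤ 9 * z ^ 2) n
  have h4 := wpSum_pos (sq_nonneg z) (by nlinarith [sq_nonneg z] : z ^ 2 ≤ 4 * z ^ 2) n
  unfold absRemainder
  positivity

theorem sinh_mul_div_pos {k z : ℝ} (hk : 0 < k) (hz : z ≠ 0) :
    0 < Real.sinh (k * z) / (k * z) := by
  rcases lt_or_gt_of_ne hz with h | h
  · have : k * z < 0 := mul_neg_of_pos_of_neg hk h
    exact div_pos_of_neg_of_neg (Real.sinh_neg_iff.2 this) this
  · have : 0 < k * z := mul_pos hk h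
    exact div_pos (Real.sinh_pos_iff.2 this) this

theorem tendsto_scaled_casoratian {z a : ℝ} (hz : z ≠ 0) (ha0 : 0 < a) (ha : a ^ 2 = 1 - a) :
    Tendsto (fun n : ℕ => (a ^ 10) ^ (n + 1)
      * (5 * (sqAddProd (4 * z ^ 2) n * sqAddProd (9 * z ^ 2) n)
        / (absRemainder z n * absRemainder z (n + 1)))) atTop
      (nhds (5 * a ^ 5 / (Real.sinh (2 * π * z) / (2 * π * z)
        * (Real.sinh (3 * π * z) / (3 * π * z))
        * (π * a ^ 2 / √(1 - a ^ 2 / 4)) ^ 2))) := by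
  have hc := Real.cosh_pos (π * z)
  have hA : 0 < Real.sinh (π * z) / (π * z) := sinh_mul_div_pos pi_pos hz
  have hB : 0 < Real.sinh (2 * π * z) / (2 * π * z) := sinh_mul_div_pos (by positivity) hz
  have hC : 0 < Real.sinh (3 * π * z) / (3 * π * z) := sinh_mul_div_pos (by positivity) hz
  have ha1 : a < 1 := by nlinarith
  have hκ : 0 < π * a ^ 2 / √(1 - a ^ 2 / 4) := by
    have : 0 < 1 - a ^ 2 / 4 := by nlinarith
    positivity
  have h1 := tendsto_sqAddProd_div_factorial hz
  have h4 := tendsto_sqAddProd_div_factorial (mul_ne_zero two_ne_zero hz)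
  have h9 := tendsto_sqAddProd_div_factorial (mul_ne_zero three_ne_zero hz)
  rw [show (2 * z) ^ 2 = 4 * z ^ 2 by ring, show π * (2 * z) = 2 * π * z by ring] at h4
  rw [show (3 * z) ^ 2 = 9 * z ^ 2 by ring, show π * (3 * z) = 3 * π * z by ring] at h9
  have hρ := tendsto_wpSum_div (sq_nonneg z) (by nlinarith [sq_nonneg z] : z ^ 2 ≤ 4 * z ^ 2)
    hB.ne' h1 h4
  have hAB : Real.sinh (π * z) / (π * z) / (Real.sinh (2 * π * z) / (2 * π * z))
      = 1 / Real.cosh (π * z) := by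
    have hs : Real.sinh (π * z) ≠ 0 := fun h => by simp [h] at hA
    rw [show 2 * π * z = 2 * (π * z) by ring, Real.sinh_two_mul]
    field_simp
  rw [hAB] at hρ
  have ht := tendsto_factorial_mul_wpSum_zero ha0 ha
  have hn : Tendsto (fun n : ℕ => (n : ℝ) / (n + 1)) atTop (nhds 1) :=
    tendsto_natCast_div_add_atTop 1
  set B := Real.sinh (2 * π * z) / (2 * π * z)
  set C := Real.sinh (3 * π * z) / (3 * π * z)
  set κ := π * a ^ 2 / √(1 - a ^ 2 / 4)
  set c := Real.cosh (π * z)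
  have hshift := tendsto_add_atTop_nat 1
  have hmain := (hn.const_mul (5 * a ^ 5)).div
    ((((h4.comp hshift).mul (h9.comp hshift)).const_mul (c ^ 2)).mul
      ((hρ.mul (hρ.comp hshift)).mul (ht.mul (ht.comp hshift)))) (by positivity)
  have e : 5 * a ^ 5 * 1 / (c ^ 2 * (B * C) * (1 / c * (1 / c) * (κ * κ)))
      = 5 * a ^ 5 / (B * C * κ ^ 2) := by
    field_simp
  rw [e] at hmain
  refine hmain.congr' ?_
  filter_upwards [eventually_gt_atTop 0] with n hn0
  have hn0' : (0 : ℝ) < n := by exact_mod_cast hn0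
  have p1 := sqAddProd_pos (by positivity : 0 ≤ 4 * z ^ 2) n
  have p2 := sqAddProd_pos (by positivity : 0 ≤ 9 * z ^ 2) n
  have p3 := sqAddProd_pos (by positivity : 0 ≤ 4 * z ^ 2) (n + 1)
  have p4 := sqAddProd_pos (by positivity : 0 ≤ 9 * z ^ 2) (n + 1)
  have p5 := wpSum_pos (sq_nonneg z) (by nlinarith [sq_nonneg z] : z ^ 2 ≤ 4 * z ^ 2) n
  have p6 := wpSum_pos (sq_nonneg z) (by nlinarith [sq_nonneg z] : z ^ 2 ≤ 4 * z ^ 2) (n + 1)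
  have p7 := wpSum_pos (le_refl (0 : ℝ)) le_rfl n
  have p8 := wpSum_pos (le_refl (0 : ℝ)) le_rfl (n + 1)
  simp only [Pi.div_apply, Function.comp_apply, absRemainder]
  rw [← pow_mul, ← pow_mul, ← pow_mul, show 10 * (n + 1) = 5 * n + 5 * (n + 1) + 5 by ring,
    pow_add, pow_add]
  rw [show Real.cosh (π * z) = c from rfl]
  have hu : 0 < a ^ (5 * n) := by positivity
  have hw : 0 < a ^ (5 * (n + 1)) := by positivity
  generalize a ^ (5 * n) = u at hu ⊢
  generalize a ^ (5 * (n + 1)) = w at hw ⊢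
  generalize sqAddProd (9 * z ^ 2) n = P at p2 ⊢
  generalize sqAddProd (9 * z ^ 2) (n + 1) = P' at p4 ⊢
  rw [Nat.factorial_succ]
  push_cast
  field_simp

/-- The continued fraction `[[0,3(1-z²),11n²-11n+3+9z²],[5,(n²+4z²)(n²+9z²)]]` converges to
`(cosh(πz)-1)/(3z²)`, with speed `(-1)ⁿ(2/(3z²))sinh(2πz)sinh(3πz)/((1+√5)/2)^(10n+5)`. -/
theorem continuous_small_apery (z : ℝ) (hz0 : z ≠ 0)
    (p q : ℕ → ℝ)
    (hp : ∀ n : ℕ, 2 ≤ n →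
      p n = (11 * (n : ℝ) ^ 2 - 11 * (n : ℝ) + 3 + 9 * z ^ 2) * p (n - 1)
              + (((n : ℝ) - 1) ^ 2 + 4 * z ^ 2) * (((n : ℝ) - 1) ^ 2 + 9 * z ^ 2) * p (n - 2))
    (hq : ∀ n : ℕ, 2 ≤ n →
      q n = (11 * (n : ℝ) ^ 2 - 11 * (n : ℝ) + 3 + 9 * z ^ 2) * q (n - 1)
              + (((n : ℝ) - 1) ^ 2 + 4 * z ^ 2) * (((n : ℝ) - 1) ^ 2 + 9 * z ^ 2) * q (n - 2))
    (hp0 : p 0 = 0) (hp1 : p 1 = 5) (hq0 : q 0 = 1) (hq1 : q 1 = 3 * (1 - z ^ 2)) :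
    (∀ᶠ n in atTop, q n ≠ 0) ∧
    Tendsto (fun n => p n / q n) atTop (nhds ((Real.cosh (π * z) - 1) / (3 * z ^ 2))) ∧
    (fun n : ℕ => (Real.cosh (π * z) - 1) / (3 * z ^ 2) - p n / q n) ~[atTop]
      (fun n : ℕ => (-1 : ℝ) ^ n * (2 / (3 * z ^ 2)) * Real.sinh (2 * π * z)
        * Real.sinh (3 * π * z) / ((1 + Real.sqrt 5) / 2) ^ (10 * n + 5)) := by
  obtain ⟨a, ha0, ha, hφ⟩ : ∃ a : ℝ, 0 < a ∧ a ^ 2 = 1 - a ∧ (1 + √5) / 2 = a⁻¹ := by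
    have h5 : √5 ^ 2 = (5 : ℝ) := Real.sq_sqrt (by norm_num)
    have h1 : 1 < √5 := by nlinarith [Real.sqrt_nonneg 5]
    refine ⟨(√5 - 1) / 2, by linarith, by linear_combination h5 / 4, ?_⟩
    refine eq_inv_of_mul_eq_one_left ?_
    linear_combination h5 / 4
  have ha1 : a < 1 := by nlinarith
  set L := (Real.cosh (π * z) - 1) / (3 * z ^ 2) with hL
  set W := absRemainder z
  have hW : ∀ n, 0 < W n := absRemainder_pos z
  have hR : ∀ n, L * q n - p n = (-1) ^ n * W n := fun n => by
    rw [remainder_eq hz0 hL hp hq hp0 hp1 hq0 hq1 n]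
    simp only [W, absRemainder]
    ring
  set x : ℕ → ℝ := fun n => q n / W n * (a ^ 10) ^ n with hx
  have hstep : ∀ n, x (n + 1) + a ^ 10 * x n = (a ^ 10) ^ (n + 1)
      * (5 * (sqAddProd (4 * z ^ 2) n * sqAddProd (9 * z ^ 2) n) / (W n * W (n + 1))) := by
    intro n
    have hcas : q (n + 1) * W n + q n * W (n + 1)
        = 5 * (sqAddProd (4 * z ^ 2) n * sqAddProd (9 * z ^ 2) n) := by
      have h1 := casoratian_eq hp hq hp0 hp1 hq0 n
      have h2 := hR (n + 1)
      rw [pow_succ] at h2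
      refine mul_left_cancel₀ (pow_ne_zero n (by norm_num : (-1 : ℝ) ≠ 0)) ?_
      linear_combination h1 - q (n + 1) * hR n + q n * h2
    have := (hW n).ne'
    have := (hW (n + 1)).ne'
    rw [← hcas, hx]
    field_simp
    ring
  have hX := tendsto_of_add_mul_tendsto (u := x) (ρ := a ^ 10) (by positivity)
    (pow_lt_one₀ ha0.le ha1 (by norm_num))
    ((tendsto_scaled_casoratian hz0 ha0 ha).congr fun n => (hstep n).symm)
  set X := 5 * a ^ 5 / (Real.sinh (2 * π * z) / (2 * π * z) * (Real.sinh (3 * π * z) / (3 * π * z))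
    * (π * a ^ 2 / √(1 - a ^ 2 / 4)) ^ 2) / (1 + a ^ 10) with hXdef
  have hXval : X * ((2 / (3 * z ^ 2)) * Real.sinh (2 * π * z) * Real.sinh (3 * π * z) * a ^ 5)
      = 1 := by
    have h2 : Real.sinh (2 * π * z) ≠ 0 := fun h => by
      simpa [h] using sinh_mul_div_pos (by positivity : 0 < 2 * π) hz0
    have h3 : Real.sinh (3 * π * z) ≠ 0 := fun h => by
      simpa [h] using sinh_mul_div_pos (by positivity : 0 < 3 * π) hz0
    have h4 : 0 < 1 - a ^ 2 / 4 := by nlinarith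
    have h10 : 1 + a ^ 10 = 20 * a ^ 6 * (1 - a ^ 2 / 4) := by
      linear_combination (a ^ 8 - a ^ 7 + 7 * a ^ 6 - 8 * a ^ 5
        - 5 * a ^ 4 - 3 * a ^ 3 - 2 * a ^ 2 - a - 1) * ha
    rw [hXdef, h10, div_pow, Real.sq_sqrt h4.le]
    generalize 1 - a ^ 2 / 4 = D at h4 ⊢
    field_simp
    ring
  have hX0 : X ≠ 0 := left_ne_zero_of_mul_eq_one hXval
  have hq0' : ∀ᶠ n in atTop, q n ≠ 0 := by
    filter_upwards [hX.eventually_ne hX0] with n hn h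
    simp [hx, h] at hn
  have hdiff : ∀ n, q n ≠ 0 → L - p n / q n = (-1) ^ n * ((a ^ 10) ^ n / x n) := by
    intro n hn
    have := (hW n).ne'
    simp only [hx]
    field_simp
    linear_combination hR n
  have hlim : Tendsto (fun n : ℕ => L - p n / q n) atTop (nhds 0) := by
    have h1 : Tendsto (fun n => (a ^ 10) ^ n / x n) atTop (nhds (0 / X)) :=
      (tendsto_pow_atTop_nhds_zero_of_lt_one (by positivity)
        (pow_lt_one₀ ha0.le ha1 (by norm_num))).div hX hX0
    rw [zero_div] at h1
    rw [tendsto_zero_iff_norm_tendsto_zero] at h1 ⊢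
    refine h1.congr' ?_
    filter_upwards [hq0'] with n hn
    rw [hdiff n hn, norm_mul, norm_pow, norm_neg, norm_one, one_pow, one_mul]
  refine ⟨hq0', ?_, isEquivalent_of_tendsto_one ?_⟩
  · simpa using hlim.const_sub L
  · have h1 := (hX.mul_const ((2 / (3 * z ^ 2)) * Real.sinh (2 * π * z) * Real.sinh (3 * π * z)
      * a ^ 5)).inv₀ (by rw [hXval]; exact one_ne_zero)
    rw [hXval, inv_one] at h1
    refine h1.congr' ?_
    filter_upwards [hq0'] with n hn
    rw [Pi.div_apply, hdiff n hn, hφ, inv_pow, div_inv_eq_mul, pow_add, pow_mul]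
    have hs : ((-1 : ℝ) ^ n) ≠ 0 := by positivity
    field_simp
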